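/- Let A be a unital complex Banach algebra, B ⊆ A a closed unital subalgebra, E,E' : A → B bounded linear maps with E(b) = b, E(bab') = bE(a)b', E'(1) = 0, E'(bab') = bE'(a)b' for all b,b' ∈ B, a ∈ A. Let (a_i)_{i≥1} be a sequence in A which is infinitesimally Boolean independent over B, centered and infinitesimally centered (E(a_i) = 0 and E'(a_i) = 0 for all i), and identically distributed (for every k ≥ 1 and all b_1,…,b_{k−1} ∈ B, the values E(a_i b_1 a_i b_2 ⋯ b_{k−1} a_i) and E'(a_i b_1 a_i b_2 ⋯ b_{k−1} a_i) do not depend on i). Let η(b) = E(a_1 b a_1), η'(b) = E'(a_1 b a_1), and S_N = (a_1 + ⋯ + a_N)/√N. Then for every k ≥ 1 and all b_0,…,b_k ∈ B, as N → ∞: E(b_0 S_N b_1 S_N b_2 ⋯ b_{k−1} S_N b_k) converges in norm to 0 if k is odd and to b_0 η(b_1) b_2 η(b_3) b_4 ⋯ b_{k−2} η(b_{k−1}) b_k if k is even (the B-valued Bernoulli moments); and E'(b_0 S_N b_1 S_N b_2 ⋯ b_{k−1} S_N b_k) converges in norm to 0 if k is odd and to Σ_{j=0}^{k/2−1} b_0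 η(b_1) b_2 ⋯ η'(b_{2j+1}) ⋯ η(b_{k−1}) b_k (the sum of the k/2 terms obtained by replacing exactly one factor η(b_{2j+1}) by η'(b_{2j+1})) if k is even (the B-valued infinitesimal Bernoulli moments). -/

import Mathlib

noncomputable section

open scoped BigOperators
open Filter Topology

variable {A : Type*} [NormedRing A] [NormedAlgebra ℂ A] [CompleteSpace A]

/-- The (non-unital) `B`-bimodule subalgebra of `A` generated by `x`: the linear span of
the products `b₀ x b₁ x ⋯ x b_m`, `m ≥ 1`, `b_i ∈ B`. -/
def genAlg (B : Set A) (x : A) : Submodule ℂ A :=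
  Submodule.span ℂ
    {a | ∃ m : ℕ, 0 < m ∧ ∃ b : Fin (m + 1) → A, (∀ i, b i ∈ B) ∧
      a = (List.ofFn fun i : Fin m => b i.castSucc * x).prod * b (Fin.last m)}

/-- The submodules `S i` are infinitesimally Boolean independent with respect to
`(E, E')`. -/
def InfBooleanIndepSeq (E E' : A → A) (S : ℕ → Submodule ℂ A) : Prop :=
  ∀ n : ℕ, 0 < n → ∀ idx : Fin n → ℕ,
    (∀ (k : Fin n) (h : k.val + 1 < n), idx k ≠ idx ⟨k.val + 1, h⟩) →
    ∀ x : Fin n → A, (∀ k, x k ∈ S (idx k)) →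
      E (List.ofFn x).prod = (List.ofFn fun k => E (x k)).prod ∧
      E' (List.ofFn x).prod =
        ∑ j : Fin n, (List.ofFn fun k => if k = j then E' (x k) else E (x k)).prod

/-- The word `b₀ s b₁ s b₂ ⋯ b_{k-1} s b_k` with `k` copies of `s`. -/
def momentWord (s : A) {k : ℕ} (b : Fin (k + 1) → A) : A :=
  (List.ofFn fun r : Fin k => b r.castSucc * s).prod * b (Fin.last k)

/-- The moments of the centered `B`-valued Bernoulli law with variance `η`:
`b₀ η(b₁) b₂ η(b₃) ⋯ η(b_{k−1}) b_k` for `k` even, `0` for `k` odd. -/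
def bernoulliMoment (η : A → A) (k : ℕ) (b : Fin (k + 1) → A) : A :=
  if Even k then
    (List.ofFn fun i : Fin (k / 2) =>
      b ⟨2 * i.val, by have := i.isLt; omega⟩ *
        η (b ⟨2 * i.val + 1, by have := i.isLt; omega⟩)).prod * b (Fin.last k)
  else 0

/-- The moments of the centered `B`-valued infinitesimal Bernoulli law with infinitesimal
variance `(η, η')`: for `k` even, the sum of the `k/2` terms obtained from the Bernoulli
moment by replacing exactly one factor `η(b_{2j+1})` by `η'(b_{2j+1})`; `0` for `k` odd. -/
def infBernoulliMoment (η η' : A → A) (k : ℕ) (b : Fin (k + 1) → A) : A :=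
  if Even k then
    ∑ j : Fin (k / 2),
      (List.ofFn fun i : Fin (k / 2) =>
        b ⟨2 * i.val, by have := i.isLt; omega⟩ *
          (if i = j then η' else η) (b ⟨2 * i.val + 1, by have := i.isLt; omega⟩)).prod *
        b (Fin.last k)
  else 0

/-- The product `b₁ s b₂ s ⋯ b_k s` for a list `[b₁, …, b_k]`. -/
def wordProd {R : Type*} [Ring R] (s : R) (l : List R) : R :=
  (l.map (· * s)).prod

/-- The product `b₁ (s - t) b₂ s ⋯ b_k s`, whose first letter is `s - t` and whose other letters
are `s`. -/
def wordProdAvoid {R : Type*} [Ring R] (s t : R) : List R → R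
  | [] => 1
  | x :: l => x * (s - t) * wordProd s l

/-- Decomposition of a word in `s` starting with the letter `t` according to the length of its
initial run of letters `t`. -/
theorem mul_wordProd_eq_sum {R : Type*} [Ring R] (s t x : R) (l : List R) :
    x * t * wordProd s l = ∑ m ∈ Finset.range (l.length + 1),
      wordProd t (x :: l.take m) * wordProdAvoid s t (l.drop m) := by
  induction l generalizing x with
  | nil => simp [wordProd, wordProdAvoid]
  | cons y l ih =>
    have h : x * t * wordProd s (y :: l) =
        x * t * (y * t * wordProd s l) + x * t * (y * (s - t) * wordProd s l) := by
      simp only [wordProd, List.map_cons, List.prod_cons]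
      noncomm_ring
    rw [h, ih y, List.length_cons, Finset.sum_range_succ' _ (l.length + 1), Finset.mul_sum]
    congr 1
    · refine Finset.sum_congr rfl fun m _ => ?_
      simp [wordProd, mul_assoc]
    · simp [wordProd, wordProdAvoid]

/-- The solution of `e [] = 1`, `e l = c ∑ κ l₁ * e l₂`, the sum being over the splittings
`l = l₁ ++ l₂` with `l₁` nonempty. -/
def booleanSum {R D : Type*} [Ring D] [Algebra ℂ D] (c : ℂ) (κ : List R → D) : List R → D
  | [] => 1
  | x :: l => c • ∑ m ∈ Finset.range (l.length + 1),
      κ (x :: l.take m) * booleanSum c κ (l.drop m)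
termination_by l => l.length
decreasing_by simp

/-- The product of `κ` over the consecutive pairs of a list, `0` for lists of odd length. -/
def pairProd {R D : Type*} [Ring D] (κ : List R → D) : List R → D
  | [] => 1
  | [_] => 0
  | x :: y :: l => κ [x, y] * pairProd κ l

theorem pairProd_ofFn_even {R D : Type*} [Ring D] (κ : List R → D) (n : ℕ) :
    ∀ (k : ℕ) (_ : k = 2 * n) (f : ℕ → R), pairProd κ (List.ofFn fun i : Fin k => f i) =
      (List.ofFn fun i : Fin n => κ [f (2 * i), f (2 * i + 1)]).prod := by
  induction n with
  | zero => rintro k rfl f; simp [pairProd]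
  | succ n ih =>
    rintro k rfl f
    have h := ih (2 * n) rfl fun i => f (i + 2)
    simp only [Nat.mul_succ, List.ofFn_succ, pairProd, List.prod_cons]
    simp only [Fin.val_succ, Fin.val_zero, mul_zero, zero_add, add_assoc, mul_add, mul_one,
      Nat.reduceAdd] at h ⊢
    rw [h]

theorem pairProd_ofFn_castSucc {R D : Type*} [Ring R] [Ring D] (κ : List R → D) {k : ℕ}
    (hk : Even k) (b : Fin (k + 1) → R) :
    pairProd κ (List.ofFn fun i : Fin k => b i.castSucc) =
      (List.ofFn fun i : Fin (k / 2) => κ [b ⟨2 * i.val, by have := i.isLt; omega⟩,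
        b ⟨2 * i.val + 1, by have := i.isLt; omega⟩]).prod := by
  have h := pairProd_ofFn_even κ (k / 2) k (Nat.two_mul_div_two_of_even hk).symm
    fun r => if hr : r < k + 1 then b ⟨r, hr⟩ else 0
  convert h using 3
  · funext i
    rw [dif_pos (by omega)]
    rfl
  · funext i
    rw [dif_pos (by omega), dif_pos (by omega)]

theorem pairProd_eq_zero_of_odd {R D : Type*} [Ring D] (κ : List R → D) :
    ∀ l : List R, Odd l.length → pairProd κ l = 0
  | [], h => by simp at h
  | [_], _ => rfl
  | x :: y :: l, h => by
    rw [pairProd, pairProd_eq_zero_of_odd κ l, mul_zero]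
    simpa [Nat.odd_add_one] using h

section Limit

variable {R D : Type*} [Ring D] [Algebra ℂ D] [TopologicalSpace D] [IsTopologicalRing D]
  [ContinuousSMul ℂ D]

/-- If `s N → 0` and `s N ^ 2 * q N → 1`, only the runs of length two contribute to the limit of
a rescaled sum over the first run. -/
theorem tendsto_smul_sum_range (κ : List R → D) (s q : ℕ → ℂ)
    (hs : Tendsto s atTop (𝓝 0)) (hq : Tendsto (fun N => s N ^ 2 * q N) atTop (𝓝 1))
    (x : R) (hκ : κ [x] = 0) (l : List R) (e : ℕ → List R → D) (L : List R → D)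
    (he : ∀ m ≤ l.length,
      Tendsto (fun N => s N ^ (l.drop m).length • e N (l.drop m)) atTop (𝓝 (L (l.drop m)))) :
    Tendsto (fun N => s N ^ (l.length + 1) • q N • ∑ m ∈ Finset.range (l.length + 1),
      κ (x :: l.take m) * e N (l.drop m)) atTop
      (𝓝 (match l with | [] => 0 | y :: l => κ [x, y] * L l)) := by
  have key : ∀ m ∈ Finset.range (l.length + 1),
      Tendsto (fun N => s N ^ (l.length + 1) • q N • (κ (x :: l.take m) * e N (l.drop m))) atTop
        (𝓝 (if m = 1 then κ (x :: l.take m) * L (l.drop m) else 0)) := by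
    intro m hm
    rw [Finset.mem_range, Nat.lt_succ_iff] at hm
    obtain rfl | hm0 := Nat.eq_zero_or_pos m
    · simp [hκ, tendsto_const_nhds]
    have h1 : Tendsto (fun N => s N ^ (m - 1) * (s N ^ 2 * q N)) atTop
        (𝓝 ((0 : ℂ) ^ (m - 1) * 1)) := (hs.pow _).mul hq
    have h2 := h1.smul (tendsto_const_nhds (x := κ (x :: l.take m)) |>.mul (he m hm))
    convert h2 using 2
    · rename_i N
      rw [mul_smul_comm, smul_smul, smul_smul]
      congr 1
      have : l.length + 1 = (m - 1) + 2 + (l.drop m).length := by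
        rw [List.length_drop]; omega
      rw [this]
      ring
    · split_ifs with h
      · simp [h]
      · rw [zero_pow (by omega), zero_mul, zero_smul]
  simp only [Finset.smul_sum]
  convert tendsto_finsetSum _ key using 2
  cases l with
  | nil => simp
  | cons y l => simp

theorem tendsto_smul_booleanSum (κ : List R → D) (s q : ℕ → ℂ)
    (hs : Tendsto s atTop (𝓝 0)) (hq : Tendsto (fun N => s N ^ 2 * q N) atTop (𝓝 1))
    (n : ℕ) : ∀ l : List R, l.length ≤ n → (∀ x ∈ l, κ [x] = 0) →
      Tendsto (fun N => s N ^ l.length • booleanSum (q N) κ l) atTop (𝓝 (pairProd κ l)) := by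
  induction n with
  | zero =>
    intro l hl _
    obtain rfl : l = [] := by simpa using hl
    simp [booleanSum, pairProd, tendsto_const_nhds]
  | succ n ih =>
    rintro (_ | ⟨x, l⟩) hl hκ
    · simp [booleanSum, pairProd, tendsto_const_nhds]
    have := tendsto_smul_sum_range κ s q hs hq x (hκ x List.mem_cons_self) l
      (fun N => booleanSum (q N) κ) (pairProd κ)
      fun m _ => ih _ (by simp at hl ⊢; omega)
        fun y hy => hκ y (List.mem_cons_of_mem _ (List.mem_of_mem_drop hy))
    simp only [booleanSum, List.length_cons]
    convert this using 2
    cases l <;> rfl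

end Limit

theorem tendsto_inv_sqrt_natCast :
    Tendsto (fun N : ℕ => (Real.sqrt N : ℂ)⁻¹) atTop (𝓝 0) := by
  have h : Tendsto (fun N : ℕ => (Real.sqrt N)⁻¹) atTop (𝓝 0) :=
    (Real.tendsto_sqrt_atTop.comp tendsto_natCast_atTop_atTop).inv_tendsto_atTop
  simpa [Function.comp_def] using (Complex.continuous_ofReal.tendsto 0).comp h

theorem tendsto_inv_sqrt_natCast_sq_mul :
    Tendsto (fun N : ℕ => ((Real.sqrt N : ℂ)⁻¹) ^ 2 * (N : ℂ)) atTop (𝓝 1) := by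
  refine tendsto_const_nhds.congr' ?_
  filter_upwards [eventually_gt_atTop 0] with N hN
  rw [inv_pow, ← Complex.ofReal_pow, Real.sq_sqrt N.cast_nonneg, Complex.ofReal_natCast,
    inv_mul_cancel₀ (Nat.cast_ne_zero.2 hN.ne')]

section Boolean

variable {R D : Type*} [Ring R] [Algebra ℂ R] [Ring D] [Algebra ℂ D]
  (B : Set R) (Φ : R →ₗ[ℂ] D) (a : ℕ → R)

/-- `Φ` is multiplicative on products of blocks of letters with alternating indices. -/
def BlockMultiplicative : Prop :=
  ∀ L : List (ℕ × List R), L.IsChain (fun p q => p.1 ≠ q.1) →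
    (∀ p ∈ L, p.2 ≠ [] ∧ ∀ b ∈ p.2, b ∈ B) →
    Φ (L.map fun p => wordProd (a p.1) p.2).prod =
      (L.map fun p => Φ (wordProd (a p.1) p.2)).prod

variable {B Φ a}

theorem BlockMultiplicative.map_mul_wordProdAvoid (hΦ : BlockMultiplicative B Φ a)
    (hident : ∀ l : List R, (∀ b ∈ l, b ∈ B) → ∀ i,
      Φ (wordProd (a i) l) = Φ (wordProd (a 0) l))
    (N n : ℕ) : ∀ (l : List R) (_ : l.length ≤ n) (_ : ∀ b ∈ l, b ∈ B) (j : ℕ) (_ : j < N)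
      (c : List R) (L : List (ℕ × List R))
      (_ : (L ++ [(j, c)]).IsChain (fun p q => p.1 ≠ q.1))
      (_ : ∀ p ∈ L ++ [(j, c)], p.2 ≠ [] ∧ ∀ b ∈ p.2, b ∈ B),
      Φ (((L ++ [(j, c)]).map fun p => wordProd (a p.1) p.2).prod *
          wordProdAvoid (∑ i ∈ Finset.range N, a i) (a j) l) =
        Φ ((L ++ [(j, c)]).map fun p => wordProd (a p.1) p.2).prod *
          booleanSum ((N : ℂ) - 1) (fun l => Φ (wordProd (a 0) l)) l := by
  induction n with
  | zero =>
    intro l hl _ j _ c L _ _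
    obtain rfl : l = [] := by simpa using hl
    simp [booleanSum, wordProdAvoid]
  | succ n ih =>
    rintro (_ | ⟨x, l⟩) hl hlB j hj c L hL hLB
    · simp [booleanSum, wordProdAvoid]
    have hsub : ∑ i ∈ Finset.range N, a i - a j = ∑ i ∈ (Finset.range N).erase j, a i := by
      rw [← Finset.sum_erase_add _ _ (Finset.mem_range.2 hj), add_sub_cancel_right]
    have hcard : (((Finset.range N).erase j).card : ℂ) = (N : ℂ) - 1 := by
      rw [Finset.card_erase_of_mem (Finset.mem_range.2 hj), Finset.card_range,
        Nat.cast_sub (by omega), Nat.cast_one]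
    rw [wordProdAvoid, booleanSum, hsub, Finset.mul_sum, Finset.sum_mul, Finset.mul_sum,
      map_sum, ← hcard, Nat.cast_smul_eq_nsmul, mul_smul_comm, ← Finset.sum_const]
    refine Finset.sum_congr rfl fun i hi => ?_
    rw [Finset.mem_erase, Finset.mem_range] at hi
    rw [hcard]
    rw [mul_wordProd_eq_sum, Finset.mul_sum, map_sum, Finset.mul_sum]
    refine Finset.sum_congr rfl fun m _ => ?_
    have hB : ∀ b ∈ x :: l.take m, b ∈ B := fun b hb =>
      hlB b (by
        rw [List.mem_cons] at hb ⊢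
        exact hb.imp_right List.mem_of_mem_take)
    have hL' : ((L ++ [(j, c)]) ++ [(i, x :: l.take m)]).IsChain (fun p q => p.1 ≠ q.1) :=
      List.isChain_append.2 ⟨hL, by simp, by simpa using hi.1.symm⟩
    have hLB' : ∀ p ∈ (L ++ [(j, c)]) ++ [(i, x :: l.take m)],
        p.2 ≠ [] ∧ ∀ b ∈ p.2, b ∈ B := by
      intro p hp
      rcases List.mem_append.1 hp with hp | hp
      · exact hLB p hp
      · obtain rfl := List.mem_singleton.1 hp
        exact ⟨by simp, hB⟩
    have hstep := ih (l.drop m) (by simp at hl ⊢; omega)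
      (fun b hb => hlB b (List.mem_cons_of_mem _ (List.mem_of_mem_drop hb))) i hi.2
      (x :: l.take m) (L ++ [(j, c)]) hL' hLB'
    rw [hΦ _ hL' hLB', List.map_append, List.prod_append, List.map_append (l₁ := L ++ [(j, c)]),
      List.prod_append, ← hΦ _ hL hLB] at hstep
    simpa [mul_assoc, hident _ hB i] using hstep

theorem BlockMultiplicative.map_wordProd_cons (hΦ : BlockMultiplicative B Φ a)
    (hident : ∀ l : List R, (∀ b ∈ l, b ∈ B) → ∀ i,
      Φ (wordProd (a i) l) = Φ (wordProd (a 0) l))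
    (N : ℕ) (x : R) (l : List R) (hlB : ∀ b ∈ x :: l, b ∈ B) :
    Φ (wordProd (∑ i ∈ Finset.range N, a i) (x :: l)) =
      (N : ℂ) • ∑ m ∈ Finset.range (l.length + 1), Φ (wordProd (a 0) (x :: l.take m)) *
        booleanSum ((N : ℂ) - 1) (fun l => Φ (wordProd (a 0) l)) (l.drop m) := by
  have h : wordProd (∑ i ∈ Finset.range N, a i) (x :: l) =
      ∑ j ∈ Finset.range N, x * a j * wordProd (∑ i ∈ Finset.range N, a i) l := by
    rw [← Finset.sum_mul, ← Finset.mul_sum]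
    simp [wordProd]
  rw [h, map_sum, Nat.cast_smul_eq_nsmul]
  refine (Finset.sum_congr rfl fun j hj => ?_).trans
    ((Finset.sum_const _).trans (by rw [Finset.card_range]))
  rw [mul_wordProd_eq_sum, map_sum]
  refine Finset.sum_congr rfl fun m _ => ?_
  have hB : ∀ b ∈ x :: l.take m, b ∈ B := fun b hb =>
    hlB b (by
      rw [List.mem_cons] at hb ⊢
      exact hb.imp_right List.mem_of_mem_take)
  have hstep := hΦ.map_mul_wordProdAvoid hident N _ (l.drop m) le_rfl
    (fun b hb => hlB b (List.mem_cons_of_mem _ (List.mem_of_mem_drop hb))) j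
    (Finset.mem_range.1 hj) (x :: l.take m) [] (by simp) (by
      intro p hp
      obtain rfl := List.mem_singleton.1 hp
      exact ⟨by simp, hB⟩)
  simpa [hident _ hB j] using hstep

/-- The Boolean central limit theorem for a linear map which is multiplicative on alternating
products of blocks. -/
theorem BlockMultiplicative.tendsto_map_wordProd [TopologicalSpace D] [IsTopologicalRing D]
    [ContinuousSMul ℂ D] (hΦ : BlockMultiplicative B Φ a)
    (hident : ∀ l : List R, (∀ b ∈ l, b ∈ B) → ∀ i,
      Φ (wordProd (a i) l) = Φ (wordProd (a 0) l))
    (hcent : ∀ x, x ∈ B → Φ (wordProd (a 0) [x]) = 0)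
    (l : List R) (hl : l ≠ []) (hlB : ∀ b ∈ l, b ∈ B) :
    Tendsto (fun N : ℕ => ((Real.sqrt N : ℂ)⁻¹) ^ l.length •
      Φ (wordProd (∑ i ∈ Finset.range N, a i) l)) atTop
      (𝓝 (pairProd (fun l => Φ (wordProd (a 0) l)) l)) := by
  obtain ⟨x, l, rfl⟩ := List.exists_cons_of_ne_nil hl
  have hs := tendsto_inv_sqrt_natCast
  have hq := tendsto_inv_sqrt_natCast_sq_mul
  have hq' : Tendsto (fun N : ℕ => ((Real.sqrt N : ℂ)⁻¹) ^ 2 * ((N : ℂ) - 1)) atTop (𝓝 1) := by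
    simpa [mul_sub] using hq.sub (hs.pow 2)
  have := tendsto_smul_sum_range (fun l => Φ (wordProd (a 0) l)) _ _ hs hq x
    (hcent x (hlB x List.mem_cons_self)) l
    (fun N => booleanSum ((N : ℂ) - 1) (fun l => Φ (wordProd (a 0) l)))
    (pairProd (fun l => Φ (wordProd (a 0) l)))
    fun m _ => tendsto_smul_booleanSum _ _ _ hs hq' _ _ le_rfl fun y hy =>
      hcent y (hlB y (List.mem_cons_of_mem _ (List.mem_of_mem_drop hy)))
  simp only [hΦ.map_wordProd_cons hident _ x l hlB, List.length_cons]
  convert this using 2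
  cases l <;> rfl

end Boolean

theorem wordProd_smul {R : Type*} [Ring R] [Algebra ℂ R] (c : ℂ) (s : R) (l : List R) :
    wordProd (c • s) l = c ^ l.length • wordProd s l := by
  induction l with
  | nil => simp [wordProd]
  | cons x l ih =>
    simp only [wordProd, List.map_cons, List.prod_cons, List.length_cons] at ih ⊢
    rw [ih, mul_smul_comm, mul_smul_comm, smul_mul_assoc, smul_smul, pow_succ]

theorem wordProd_cons_eq {R : Type*} [Ring R] (s x : R) (l : List R) :
    wordProd s (x :: l) = x * ((List.ofFn fun r => s * l.get r).prod * s) := by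
  induction l generalizing x with
  | nil => simp [wordProd]
  | cons y l ih =>
    have h : wordProd s (x :: y :: l) = x * s * wordProd s (y :: l) := by simp [wordProd]
    rw [h, ih]
    simp [mul_assoc, List.ofFn_succ]

theorem TrivSqZeroExt.fst_prod_ofFn {R : Type*} [Ring R] {n : ℕ} (g : Fin n → TrivSqZeroExt R R) :
    (List.ofFn g).prod.fst = (List.ofFn fun i => (g i).fst).prod := by
  induction n with
  | zero => simp
  | succ n ih => simp [List.ofFn_succ, ih]

theorem TrivSqZeroExt.snd_prod_ofFn {R : Type*} [Ring R] {n : ℕ} (g : Fin n → TrivSqZeroExt R R) :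
    (List.ofFn g).prod.snd =
      ∑ j, (List.ofFn fun i => if i = j then (g i).snd else (g i).fst).prod := by
  induction n with
  | zero => simp
  | succ n ih =>
    simp [List.ofFn_succ, ih, Fin.sum_univ_succ, TrivSqZeroExt.fst_prod_ofFn, Finset.mul_sum,
      Fin.succ_ne_zero, (Fin.succ_ne_zero _).symm, add_comm]

/-- The map `x ↦ E x + ε E' x` into the dual numbers. -/
def dualMap {R : Type*} [Ring R] [Algebra ℂ R] (E E' : R →ₗ[ℂ] R) :
    R →ₗ[ℂ] TrivSqZeroExt R R where
  toFun x := TrivSqZeroExt.inl (E x) + TrivSqZeroExt.inr (E' x)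
  map_add' x y := by ext <;> simp
  map_smul' c x := by ext <;> simp

section DualMap

variable {R : Type*} [Ring R] [Algebra ℂ R] (E E' : R →ₗ[ℂ] R)

@[simp]
theorem fst_dualMap (x : R) : (dualMap E E' x).fst = E x := by simp [dualMap]

@[simp]
theorem snd_dualMap (x : R) : (dualMap E E' x).snd = E' x := by simp [dualMap]

end DualMap

section NormedAlgebra

variable {R : Type*} [NormedRing R]

variable {k : ℕ} {b : Fin (k + 1) → R} {κ : List R → TrivSqZeroExt R R} {η η' : R → R}

theorem fst_pairProd_mul_eq_bernoulliMoment (hη : ∀ r s, (κ [b r, b s]).fst = b r * η (b s)) :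
    (pairProd κ (List.ofFn fun i : Fin k => b i.castSucc)).fst * b (Fin.last k) =
      bernoulliMoment η k b := by
  rw [bernoulliMoment]
  split_ifs with hk
  · simp only [pairProd_ofFn_castSucc κ hk, TrivSqZeroExt.fst_prod_ofFn, hη]
  · rw [pairProd_eq_zero_of_odd _ _ (by simpa using hk), TrivSqZeroExt.fst_zero, zero_mul]

theorem snd_pairProd_mul_eq_infBernoulliMoment
    (hη : ∀ r s, (κ [b r, b s]).fst = b r * η (b s))
    (hη' : ∀ r s, (κ [b r, b s]).snd = b r * η' (b s)) :
    (pairProd κ (List.ofFn fun i : Fin k => b i.castSucc)).snd * b (Fin.last k) =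
      infBernoulliMoment η η' k b := by
  rw [infBernoulliMoment]
  split_ifs with hk
  · simp only [pairProd_ofFn_castSucc κ hk, TrivSqZeroExt.snd_prod_ofFn, hη, hη',
      Finset.sum_mul]
    refine Finset.sum_congr rfl fun j _ => ?_
    congr! 4 with i
    split_ifs <;> rfl
  · rw [pairProd_eq_zero_of_odd _ _ (by simpa using hk), TrivSqZeroExt.snd_zero, zero_mul]

variable [NormedAlgebra ℂ R]

theorem wordProd_mem_genAlg {B : Subalgebra ℂ R} (x : R) (l : List R) (hl : l ≠ [])
    (hlB : ∀ b ∈ l, b ∈ B) : wordProd x l ∈ genAlg (B : Set R) x := by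
  refine Submodule.subset_span ⟨l.length, List.length_pos_iff.2 hl,
    Fin.snoc (α := fun _ => R) l.get 1, fun i => ?_, ?_⟩
  · refine Fin.lastCases ?_ (fun i => ?_) i
    · simp [B.one_mem]
    · simpa using hlB _ (List.getElem_mem _)
  · simp [wordProd, List.ofFn_getElem_eq_map l (· * x)]

theorem InfBooleanIndepSeq.blockMultiplicative {B : Subalgebra ℂ R} {E E' : R →ₗ[ℂ] R}
    {a : ℕ → R} (hindep : InfBooleanIndepSeq E E' fun i => genAlg (B : Set R) (a i))
    (hE : E 1 = 1) (hE' : E' 1 = 0) : BlockMultiplicative (B : Set R) (dualMap E E') a := by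
  intro L hL hLB
  obtain rfl | hne := eq_or_ne L []
  · ext <;> simp [hE, hE']
  have h := hindep L.length (List.length_pos_iff.2 hne) (fun k => (L.get k).1)
    (fun k hk => List.isChain_iff_getElem.1 hL k hk)
    (fun k => wordProd (a (L.get k).1) (L.get k).2)
    fun k => wordProd_mem_genAlg _ _ (hLB _ (L.get_mem k)).1 (hLB _ (L.get_mem k)).2
  have hmap : ∀ {X : Type _} (g : ℕ × List R → X),
      L.map g = List.ofFn fun k => g (L.get k) := fun g => by
    conv_lhs => rw [← List.ofFn_get L, List.map_ofFn]
    rfl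
  rw [hmap, hmap]
  ext
  · simpa [TrivSqZeroExt.fst_prod_ofFn] using h.1
  · simpa [TrivSqZeroExt.snd_prod_ofFn] using h.2

theorem map_wordProd_eq_of_identDistrib {B : Subalgebra ℂ R} {F : R → R} {x y : R}
    (hF : ∀ z, ∀ c ∈ B, F (c * z) = c * F z)
    (hxy : ∀ (k : ℕ) (b : Fin k → R), (∀ r, b r ∈ B) →
      F ((List.ofFn fun r : Fin k => x * b r).prod * x) =
        F ((List.ofFn fun r : Fin k => y * b r).prod * y))
    (l : List R) (hl : ∀ c ∈ l, c ∈ B) : F (wordProd x l) = F (wordProd y l) := by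
  obtain _ | ⟨c, l⟩ := l
  · rfl
  rw [wordProd_cons_eq, wordProd_cons_eq, hF _ c (hl c List.mem_cons_self),
    hF _ c (hl c List.mem_cons_self), hxy _ _ fun r => hl _ (List.mem_cons_of_mem _ (l.get_mem r))]

theorem map_momentWord_smul {F : R →ₗ[ℂ] R}
    (hF : ∀ z, F (z * b (Fin.last k)) = F z * b (Fin.last k)) (c : ℂ) (s : R) :
    F (momentWord (c • s) b) =
      c ^ k • F (wordProd s (List.ofFn fun i : Fin k => b i.castSucc)) * b (Fin.last k) := by
  have h : momentWord (c • s) b =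
      wordProd (c • s) (List.ofFn fun i : Fin k => b i.castSucc) * b (Fin.last k) := by
    simp [momentWord, wordProd, List.map_ofFn, Function.comp_def]
  rw [h, hF, wordProd_smul, map_smul, List.length_ofFn]

end NormedAlgebra

/-- Theorem (operator-valued infinitesimal Boolean central limit theorem): for a
centered, infinitesimally centered, identically distributed, infinitesimally Boolean
independent sequence `(aᵢ)` in a Banach OVI probability space `(A, B, E, E')` with
variance `η` and infinitesimal variance `η'`, the `E`-moments of `S_N = (a₁+⋯+a_N)/√N`
converge to the `B`-valued Bernoulli moments and the `E'`-moments converge to the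
`B`-valued infinitesimal Bernoulli moments. -/
theorem ovi_boolean_clt
    (B : Subalgebra ℂ A) (hBclosed : IsClosed (B : Set A))
    (E E' : A →L[ℂ] A)
    (hErange : ∀ a, E a ∈ B) (hEproj : ∀ b ∈ B, E b = b)
    (hEbimod : ∀ a : A, ∀ b ∈ B, ∀ b' ∈ B, E (b * a * b') = b * E a * b')
    (hE'range : ∀ a, E' a ∈ B) (hE'one : E' 1 = 0)
    (hE'bimod : ∀ a : A, ∀ b ∈ B, ∀ b' ∈ B, E' (b * a * b') = b * E' a * b')
    (a : ℕ → A)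
    (hindep : InfBooleanIndepSeq ⇑E ⇑E' fun i => genAlg (B : Set A) (a i))
    (hcent : ∀ i, E (a i) = 0) (hcent' : ∀ i, E' (a i) = 0)
    (hident : ∀ (k : ℕ) (b : Fin k → A), (∀ r, b r ∈ B) → ∀ i j : ℕ,
      E ((List.ofFn fun r : Fin k => a i * b r).prod * a i) =
        E ((List.ofFn fun r : Fin k => a j * b r).prod * a j) ∧
      E' ((List.ofFn fun r : Fin k => a i * b r).prod * a i) =
        E' ((List.ofFn fun r : Fin k => a j * b r).prod * a j))
    (k : ℕ) (hk : 1 ≤ k) (b : Fin (k + 1) → A) (hb : ∀ r, b r ∈ B) :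
    Tendsto
      (fun N : ℕ =>
        E (momentWord (((Real.sqrt N : ℂ))⁻¹ • ∑ i ∈ Finset.range N, a i) b))
      atTop (𝓝 (bernoulliMoment (fun c => E (a 0 * c * a 0)) k b)) ∧
    Tendsto
      (fun N : ℕ =>
        E' (momentWord (((Real.sqrt N : ℂ))⁻¹ • ∑ i ∈ Finset.range N, a i) b))
      atTop
      (𝓝 (infBernoulliMoment (fun c => E (a 0 * c * a 0))
        (fun c => E' (a 0 * c * a 0)) k b)) := by
  have hEl : ∀ z, ∀ c ∈ B, E (c * z) = c * E z := fun z c hc => by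
    simpa using hEbimod z c hc 1 B.one_mem
  have hE'l : ∀ z, ∀ c ∈ B, E' (c * z) = c * E' z := fun z c hc => by
    simpa using hE'bimod z c hc 1 B.one_mem
  have hEr : ∀ z, ∀ c ∈ B, E (z * c) = E z * c := fun z c hc => by
    simpa using hEbimod z 1 B.one_mem c hc
  have hE'r : ∀ z, ∀ c ∈ B, E' (z * c) = E' z * c := fun z c hc => by
    simpa using hE'bimod z 1 B.one_mem c hc
  have hΦ : BlockMultiplicative (B : Set A) (dualMap (E : A →ₗ[ℂ] A) (E' : A →ₗ[ℂ] A)) a :=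
    InfBooleanIndepSeq.blockMultiplicative hindep (hEproj 1 B.one_mem) hE'one
  have hlim := hΦ.tendsto_map_wordProd
    (fun l hl i => by
      ext
      · simpa using map_wordProd_eq_of_identDistrib hEl
          (fun n c hc => (hident n c hc i 0).1) l hl
      · simpa using map_wordProd_eq_of_identDistrib hE'l
          (fun n c hc => (hident n c hc i 0).2) l hl)
    (fun x hx => by
      ext
      · simp [wordProd, hEl _ x hx, hcent]
      · simp [wordProd, hE'l _ x hx, hcent'])
    (List.ofFn fun i : Fin k => b i.castSucc) (by simp; omega)
    (by simpa [List.mem_ofFn] using fun i => hb _)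
  have hη : ∀ r s, (dualMap (E : A →ₗ[ℂ] A) (E' : A →ₗ[ℂ] A) (wordProd (a 0) [b r, b s])).fst =
      b r * E (a 0 * b s * a 0) := fun r s => by
    simp [wordProd, mul_assoc, hEl _ _ (hb r)]
  have hη' : ∀ r s, (dualMap (E : A →ₗ[ℂ] A) (E' : A →ₗ[ℂ] A) (wordProd (a 0) [b r, b s])).snd =
      b r * E' (a 0 * b s * a 0) := fun r s => by
    simp [wordProd, mul_assoc, hE'l _ _ (hb r)]
  rw [List.length_ofFn] at hlim
  constructor
  · rw [← fst_pairProd_mul_eq_bernoulliMoment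
      (κ := fun l => dualMap (E : A →ₗ[ℂ] A) (E' : A →ₗ[ℂ] A) (wordProd (a 0) l)) hη]
    refine (((TrivSqZeroExt.continuous_fst.tendsto _).comp hlim).mul_const _).congr fun N => ?_
    simpa using (map_momentWord_smul (F := (E : A →ₗ[ℂ] A)) (fun z => hEr z _ (hb _))
      (Real.sqrt N : ℂ)⁻¹ (∑ i ∈ Finset.range N, a i)).symm
  · rw [← snd_pairProd_mul_eq_infBernoulliMoment
      (κ := fun l => dualMap (E : A →ₗ[ℂ] A) (E' : A →ₗ[ℂ] A) (wordProd (a 0) l)) hη hη']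
    refine (((TrivSqZeroExt.continuous_snd.tendsto _).comp hlim).mul_const _).congr fun N => ?_
    simpa using (map_momentWord_smul (F := (E' : A →ₗ[ℂ] A)) (fun z => hE'r z _ (hb _))
      (Real.sqrt N : ℂ)⁻¹ (∑ i ∈ Finset.range N, a i)).symm
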